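/- (Statistical consistency of the hierarchy) Let p ∈ [1,∞), q ≥ 1 and let r be a positive integer. Suppose the empirical distortion distances converge in expectation: E[Δ((𝒳,d_𝒳,μ̂_n),(𝒳,d_𝒳,μ))] → 0 and E[Δ((𝒴,d_𝒴,ν̂_n),(𝒴,d_𝒴,ν))] → 0 as n → ∞ (where Δ := gw^{1/p} with the distortion cost). Then E[Δ^{(r)}((𝒳,d_𝒳,μ̂_n),(𝒴,d_𝒴,ν̂_n))] → Δ^{(r)}((𝒳,d_𝒳,μ),(𝒴,d_𝒴,ν)) as n → ∞. -/

import Mathlib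

open MeasureTheory Metric Filter Set

namespace GWSOS

variable {X Y : Type*}

/-- The set of couplings of `μ` and `ν`. -/
def Couplings [MeasurableSpace X] [MeasurableSpace Y] (μ : Measure X) (ν : Measure Y) :
    Set (Measure (X × Y)) :=
  {π | IsProbabilityMeasure π ∧ π.map Prod.fst = μ ∧ π.map Prod.snd = ν}

/-- The Gromov–Wasserstein value for cost `c`. -/
noncomputable def gwVal [MeasurableSpace X] [MeasurableSpace Y]
    (c : X × Y → X × Y → ℝ) (μ : Measure X) (ν : Measure Y) : ℝ :=
  ⨅ π : Couplings μ ν,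
    ∫ z, c z.1 z.2 ∂((π : Measure (X × Y)).prod (π : Measure (X × Y)))

/-- (Sym): invariance under permutation of the `2r` coordinate pairs. -/
def SymCond [MeasurableSpace X] [MeasurableSpace Y] (r : ℕ)
    (P : Measure (Fin (2 * r) → X × Y)) : Prop :=
  ∀ σ : Equiv.Perm (Fin (2 * r)), P.map (fun z => z ∘ σ) = P

/-- (Mar): marginal conditions. -/
def MarCond [MeasurableSpace X] [MeasurableSpace Y] (r : ℕ)
    (μ : Measure X) (ν : Measure Y) (P : Measure (Fin (2 * r) → X × Y)) : Prop :=
  ∀ i : Fin (2 * r),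
    P.map (fun z => ((z i).1, fun j : {j : Fin (2 * r) // j ≠ i} => z j.1))
      = μ.prod (P.map (fun z (j : {j : Fin (2 * r) // j ≠ i}) => z j.1)) ∧
    P.map (fun z => ((z i).2, fun j : {j : Fin (2 * r) // j ≠ i} => z j.1))
      = ν.prod (P.map (fun z (j : {j : Fin (2 * r) // j ≠ i}) => z j.1))

/-- (PSD+): the positive semidefiniteness condition. -/
def PSDCond [MeasurableSpace X] [MeasurableSpace Y] (r : ℕ)
    (P : Measure (Fin (2 * r) → X × Y)) : Prop :=
  ∀ (t : ℕ) (ht : t ≤ r) (f : (Fin t → X × Y) → ℝ) (g : (Fin (2 * r - 2 * t) → X × Y) → ℝ),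
    Measurable f → (∃ M, ∀ w, |f w| ≤ M) →
    Measurable g → (∃ M, ∀ w, |g w| ≤ M) → (∀ w, 0 ≤ g w) →
    0 ≤ ∫ z, (f fun s => z ⟨s.1, by have := s.isLt; omega⟩)
          * (f fun s => z ⟨t + s.1, by have := s.isLt; omega⟩)
          * (g fun s => z ⟨2 * t + s.1, by have := s.isLt; omega⟩) ∂P

/-- The feasible set `Π_r(μ,ν)` of the level-`r` relaxation. -/
def PiRSet [MeasurableSpace X] [MeasurableSpace Y] (r : ℕ)
    (μ : Measure X) (ν : Measure Y) : Set (Measure (Fin (2 * r) → X × Y)) :=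
  {P | IsProbabilityMeasure P ∧ SymCond r P ∧ MarCond r μ ν P ∧ PSDCond r P}

/-- The level-`r` SOS value `gw^{(r)}(μ,ν)`. -/
noncomputable def gwRVal [MeasurableSpace X] [MeasurableSpace Y] (r : ℕ) (hr : 0 < r)
    (c : X × Y → X × Y → ℝ) (μ : Measure X) (ν : Measure Y) : ℝ :=
  ⨅ P : PiRSet r μ ν,
    ∫ z, c (z ⟨0, by omega⟩) (z ⟨1, by omega⟩) ∂(P : Measure (Fin (2 * r) → X × Y))

/-- `c` is Lipschitz with constant `C` for the sum metric. -/
def LipCost [PseudoMetricSpace X] [PseudoMetricSpace Y] (C : ℝ)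
    (c : X × Y → X × Y → ℝ) : Prop :=
  ∀ z₁ z₂ w₁ w₂ : X × Y,
    |c z₁ z₂ - c w₁ w₂|
      ≤ C * (dist z₁.1 w₁.1 + dist z₁.2 w₁.2 + dist z₂.1 w₂.1 + dist z₂.2 w₂.2)

/-- The `L^{p,q}` distortion cost. -/
noncomputable def distCost [PseudoMetricSpace X] [PseudoMetricSpace Y] (p q : ℝ)
    (z w : X × Y) : ℝ :=
  |dist z.1 w.1 ^ q - dist z.2 w.2 ^ q| ^ p

end GWSOS

namespace GWSOS

variable {X : Type*}

/-- Minimal number of `ε`-balls needed to cover `S`. -/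
noncomputable def coverNum [PseudoMetricSpace X] (ε : ℝ) (S : Set X) : ℕ :=
  sInf {m | ∃ F : Finset X, F.card = m ∧ S ⊆ ⋃ x ∈ F, Metric.ball x ε}

/-- The `(ε,τ)`-covering number of `μ`. -/
noncomputable def coverNumMeas [PseudoMetricSpace X] [MeasurableSpace X]
    (μ : Measure X) (ε τ : ℝ) : ℕ :=
  sInf {m | ∃ S : Set X, MeasurableSet S ∧ ENNReal.ofReal (1 - τ) ≤ μ S ∧ coverNum ε S = m}

/-- The `(ε,τ)`-dimension of `μ`. -/
noncomputable def dimEps [PseudoMetricSpace X] [MeasurableSpace X]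
    (μ : Measure X) (ε τ : ℝ) : ℝ :=
  Real.log (coverNumMeas μ ε τ) / (- Real.log ε)

/-- The empirical measure of the sample `ω`. -/
noncomputable def empMeas [MeasurableSpace X] (n : ℕ) (ω : Fin n → X) : Measure X :=
  ∑ i : Fin n, (n : ENNReal)⁻¹ • Measure.dirac (ω i)

end GWSOS

namespace GWSOS

section Auxiliary

open ProbabilityTheory

variable {X Y U V : Type*} [MeasurableSpace X] [MeasurableSpace Y]
  [MeasurableSpace U] [MeasurableSpace V]

theorem map_prodProdProdComm {A B C D : Type*} [MeasurableSpace A] [MeasurableSpace B]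
    [MeasurableSpace C] [MeasurableSpace D] (a : Measure A) (b : Measure B) (c : Measure C)
    (d : Measure D) [SFinite a] [SFinite b] [SFinite c] [SFinite d] :
    ((a.prod b).prod (c.prod d)).map (fun z => ((z.1.1, z.2.1), (z.1.2, z.2.2)))
      = (a.prod c).prod (b.prod d) := by
  refine Measure.ext_of_lintegral _ fun f hf => ?_
  rw [lintegral_map hf (by fun_prop), lintegral_prod _ (by fun_prop),
    lintegral_prod _ (by fun_prop), lintegral_prod _ (by fun_prop),
    lintegral_prod _ (by fun_prop)]
  refine lintegral_congr fun x => ?_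
  have h1 (y : B) : ∫⁻ w, f ((x, w.1), (y, w.2)) ∂(c.prod d)
      = ∫⁻ u, ∫⁻ v, f ((x, u), (y, v)) ∂d ∂c := lintegral_prod _ (by fun_prop)
  have h2 (u : C) : ∫⁻ w, f ((x, u), w) ∂(b.prod d)
      = ∫⁻ y, ∫⁻ v, f ((x, u), (y, v)) ∂d ∂b := lintegral_prod _ (by fun_prop)
  simp only [h1, h2]
  exact lintegral_lintegral_swap (by fun_prop)

theorem map_pi_sum {ι ι₁ ι₂ W : Type*} [Fintype ι] [Fintype ι₁] [Fintype ι₂] [MeasurableSpace W]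
    (ρ : Measure W) [SigmaFinite ρ] (e : ι₁ ⊕ ι₂ ≃ ι) :
    (Measure.pi fun _ : ι => ρ).map
        (fun u => ((fun a => u (e (.inl a))), (fun b => u (e (.inr b)))))
      = (Measure.pi fun _ : ι₁ => ρ).prod (Measure.pi fun _ : ι₂ => ρ) := by
  have h1 := (measurePreserving_piCongrLeft (fun _ : ι => ρ) e).symm
  have h2 := measurePreserving_sumPiEquivProdPi (fun _ : ι₁ ⊕ ι₂ => ρ)
  exact (h2.comp h1).map_eq

theorem map_pi_comp_equiv {ι ι₁ W : Type*} [Fintype ι] [Fintype ι₁] [MeasurableSpace W]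
    (ρ : Measure W) [SigmaFinite ρ] (e : ι₁ ≃ ι) :
    (Measure.pi fun _ : ι => ρ).map (fun u => u ∘ e) = Measure.pi fun _ : ι₁ => ρ :=
  (measurePreserving_piCongrLeft (fun _ : ι => ρ) e).symm.map_eq

theorem map_pi_eval_rest {ι W : Type*} [Fintype ι] [DecidableEq ι] [MeasurableSpace W]
    (ρ : Measure W) [SigmaFinite ρ] (i : ι) :
    (Measure.pi fun _ : ι => ρ).map (fun u => (u i, fun j : {j // j ≠ i} => u j.1))
      = ρ.prod (Measure.pi fun _ : {j // j ≠ i} => ρ) := by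
  have h := map_pi_sum ρ (Equiv.sumCompl (fun j : ι => j = i))
  have hU : (Measure.pi fun _ : {j // j = i} => ρ).map
      (MeasurableEquiv.funUnique {j // j = i} W) = ρ := by
    convert (measurePreserving_funUnique ρ {j // j = i}).map_eq
  have := congrArg (Measure.map (Prod.map (MeasurableEquiv.funUnique {j // j = i} W) id)) h
  rw [← Measure.map_prod_map _ _ (by fun_prop) (by fun_prop), hU, Measure.map_id,
    Measure.map_map (by fun_prop) (by fun_prop)] at this
  exact this

/-- Attach an independent noise coordinate to every point of a tuple of pairs. -/
def attachNoise {ι : Type*} (w : (ι → X × Y) × (ι → U × V)) (i : ι) : (X × U) × (Y × V) :=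
  (((w.1 i).1, (w.2 i).1), ((w.1 i).2, (w.2 i).2))

theorem measurable_attachNoise {ι : Type*} :
    Measurable (attachNoise : (ι → X × Y) × (ι → U × V) → ι → (X × U) × (Y × V)) := by
  unfold attachNoise; fun_prop

/-- The law of a random tuple with independent noise attached to every coordinate. -/
noncomputable def noisy {ι : Type*} [Fintype ι] (P : Measure (ι → X × Y)) (α : Measure U)
    (β : Measure V) : Measure (ι → (X × U) × (Y × V)) :=
  (P.prod (Measure.pi fun _ : ι => α.prod β)).map attachNoise

variable {r : ℕ} {μ : Measure X} {ν : Measure Y} {P : Measure (Fin (2 * r) → X × Y)}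
  (α : Measure U) (β : Measure V) [IsProbabilityMeasure α] [IsProbabilityMeasure β]

theorem map_noisy [IsProbabilityMeasure P] :
    (noisy P α β).map (fun w i => ((w i).1.1, (w i).2.1)) = P := by
  rw [noisy, Measure.map_map (by fun_prop) measurable_attachNoise]
  exact measurePreserving_fst.map_eq

theorem SymCond.noisy [SFinite P] (h : SymCond r P) : SymCond r (noisy P α β) := by
  intro σ
  have hσ : (P.prod (Measure.pi fun _ : Fin (2 * r) => α.prod β)).map
      (Prod.map (fun z => z ∘ σ) (fun u => u ∘ σ))
      = P.prod (Measure.pi fun _ : Fin (2 * r) => α.prod β) := by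
    rw [← Measure.map_prod_map _ _ (by fun_prop) (by fun_prop), h σ, map_pi_comp_equiv]
  rw [GWSOS.noisy, Measure.map_map (by fun_prop) measurable_attachNoise]
  conv_rhs => rw [← hσ, Measure.map_map measurable_attachNoise (by fun_prop)]
  rfl

theorem MarCond.noisy [IsProbabilityMeasure P] [SFinite μ] [SFinite ν] (h : MarCond r μ ν P) :
    MarCond r (μ.prod α) (ν.prod β) (noisy P α β) := by
  intro i
  obtain ⟨h1, h2⟩ := h i
  set R : (Fin (2 * r) → X × Y) → ({j : Fin (2 * r) // j ≠ i} → X × Y) := fun z j => z j.1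
  have hR : Measurable R := by fun_prop
  set ρ := Measure.pi fun _ : {j : Fin (2 * r) // j ≠ i} => α.prod β
  have hpi := map_pi_eval_rest (α.prod β) i
  have hrest : (GWSOS.noisy P α β).map (fun z (j : {j : Fin (2 * r) // j ≠ i}) => z j.1)
      = ((P.map R).prod ρ).map attachNoise := by
    have hpi' : (Measure.pi fun _ : Fin (2 * r) => α.prod β).map
        (fun u (j : {j : Fin (2 * r) // j ≠ i}) => u j.1) = ρ := by
      have := congrArg (Measure.map Prod.snd) hpi
      rwa [Measure.map_map (by fun_prop) (by fun_prop), Measure.map_snd_prod, measure_univ,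
        one_smul] at this
    rw [GWSOS.noisy, Measure.map_map (by fun_prop) measurable_attachNoise, ← hpi',
      Measure.map_prod_map _ _ hR (by fun_prop),
      Measure.map_map measurable_attachNoise (by fun_prop)]
    rfl
  have : IsProbabilityMeasure (P.map R) := Measure.isProbabilityMeasure_map hR.aemeasurable
  rw [hrest]
  constructor
  · have hu : (Measure.pi fun _ : Fin (2 * r) => α.prod β).map
        (fun u => ((u i).1, fun j : {j : Fin (2 * r) // j ≠ i} => u j.1)) = α.prod ρ := by
      have := congrArg (Measure.map (Prod.map Prod.fst id)) hpi
      rwa [Measure.map_map (by fun_prop) (by fun_prop),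
        ← Measure.map_prod_map _ _ (by fun_prop) (by fun_prop), Measure.map_fst_prod, measure_univ,
        one_smul, Measure.map_id] at this
    have key := map_prodProdProdComm μ (P.map R) α ρ
    rw [← h1, ← hu, Measure.map_prod_map _ _ (by fun_prop) (by fun_prop),
      Measure.map_map (by fun_prop) (by fun_prop)] at key
    conv_rhs => rw [← Measure.map_id (μ := μ.prod α)]
    rw [Measure.map_prod_map _ _ (by fun_prop) measurable_attachNoise, ← key, GWSOS.noisy,
      Measure.map_map (by fun_prop) measurable_attachNoise,
      Measure.map_map (measurable_id.prodMap measurable_attachNoise) (by fun_prop)]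
    rfl
  · have hu : (Measure.pi fun _ : Fin (2 * r) => α.prod β).map
        (fun u => ((u i).2, fun j : {j : Fin (2 * r) // j ≠ i} => u j.1)) = β.prod ρ := by
      have := congrArg (Measure.map (Prod.map Prod.snd id)) hpi
      rwa [Measure.map_map (by fun_prop) (by fun_prop),
        ← Measure.map_prod_map _ _ (by fun_prop) (by fun_prop), Measure.map_snd_prod, measure_univ,
        one_smul, Measure.map_id] at this
    have key := map_prodProdProdComm ν (P.map R) β ρ
    rw [← h2, ← hu, Measure.map_prod_map _ _ (by fun_prop) (by fun_prop),
      Measure.map_map (by fun_prop) (by fun_prop)] at key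
    conv_rhs => rw [← Measure.map_id (μ := ν.prod β)]
    rw [Measure.map_prod_map _ _ (by fun_prop) measurable_attachNoise, ← key, GWSOS.noisy,
      Measure.map_map (by fun_prop) measurable_attachNoise,
      Measure.map_map (measurable_id.prodMap measurable_attachNoise) (by fun_prop)]
    rfl

theorem integrable_of_abs_le {Ω : Type*} [MeasurableSpace Ω] {τ : Measure Ω} [IsFiniteMeasure τ]
    {f : Ω → ℝ} (hf : Measurable f) {M : ℝ} (hM : ∀ w, |f w| ≤ M) : Integrable f τ :=
  Integrable.of_bound hf.aestronglyMeasurable M (.of_forall hM)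

theorem abs_integral_le_of_abs_le {Ω : Type*} [MeasurableSpace Ω] {τ : Measure Ω}
    [IsProbabilityMeasure τ] {f : Ω → ℝ} {M : ℝ} (hM : ∀ w, |f w| ≤ M) :
    |∫ w, f w ∂τ| ≤ M := by
  simpa using norm_integral_le_of_norm_le_const (f := f) (μ := τ) (.of_forall hM)

theorem integral_mul_mul_pi {W : Type*} [MeasurableSpace W] (ρ : Measure W)
    [IsProbabilityMeasure ρ] {r t : ℕ} (ht : t ≤ r) {f₁ f₂ : (Fin t → W) → ℝ}
    {g : (Fin (2 * r - 2 * t) → W) → ℝ} (hf₁ : Measurable f₁) (hf₂ : Measurable f₂)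
    (hg : Measurable g) :
    ∫ u, (f₁ fun s => u ⟨s.1, by have := s.isLt; omega⟩)
        * (f₂ fun s => u ⟨t + s.1, by have := s.isLt; omega⟩)
        * (g fun s => u ⟨2 * t + s.1, by have := s.isLt; omega⟩)
        ∂(Measure.pi fun _ : Fin (2 * r) => ρ)
      = (∫ a, f₁ a ∂(Measure.pi fun _ => ρ)) * (∫ a, f₂ a ∂(Measure.pi fun _ => ρ))
        * ∫ b, g b ∂(Measure.pi fun _ => ρ) := by
  let e₁ : Fin (t + t) ⊕ Fin (2 * r - 2 * t) ≃ Fin (2 * r) :=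
    finSumFinEquiv.trans (finCongr (by omega))
  have h₁ := map_pi_sum ρ e₁
  have h₂ := map_pi_sum ρ (finSumFinEquiv (m := t) (n := t))
  rw [← integral_prod_mul, ← h₂, integral_map (by fun_prop)
    (Measurable.aestronglyMeasurable (by fun_prop)), ← integral_prod_mul, ← h₁,
    integral_map (by fun_prop) (Measurable.aestronglyMeasurable (by fun_prop))]
  congr! 7
  simp [e₁]
  omega

theorem PSDCond.noisy [IsProbabilityMeasure P] (h : PSDCond r P) : PSDCond r (noisy P α β) := by
  rintro t ht f g hf ⟨M, hM⟩ hg ⟨N, hN⟩ hg0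
  rw [GWSOS.noisy, integral_map measurable_attachNoise.aemeasurable
    (by refine Measurable.aestronglyMeasurable ?_; fun_prop), integral_prod]
  · let F : (Fin t → X × Y) → ℝ := fun a =>
      ∫ u, f (attachNoise (a, u)) ∂(Measure.pi fun _ : Fin t => α.prod β)
    let G : (Fin (2 * r - 2 * t) → X × Y) → ℝ := fun a =>
      ∫ u, g (attachNoise (a, u)) ∂(Measure.pi fun _ => α.prod β)
    have hF : Measurable F :=
      (hf.comp measurable_attachNoise).stronglyMeasurable.integral_prod_right'.measurable
    have hG : Measurable G :=
      (hg.comp measurable_attachNoise).stronglyMeasurable.integral_prod_right'.measurable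
    have := h t ht F G hF ⟨M, fun w => abs_integral_le_of_abs_le fun _ => hM _⟩ hG
      ⟨N, fun w => abs_integral_le_of_abs_le fun _ => hN _⟩ fun w => integral_nonneg fun _ => hg0 _
    convert this using 2
    ext z
    exact integral_mul_mul_pi (α.prod β) ht
      (f₁ := fun u => f (attachNoise (fun s => z ⟨s.1, by have := s.isLt; omega⟩, u)))
      (f₂ := fun u => f (attachNoise (fun s => z ⟨t + s.1, by have := s.isLt; omega⟩, u)))
      (g := fun u => g (attachNoise (fun s => z ⟨2 * t + s.1, by have := s.isLt; omega⟩, u)))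
      (hf.comp (measurable_attachNoise.comp (by fun_prop)))
      (hf.comp (measurable_attachNoise.comp (by fun_prop)))
      (hg.comp (measurable_attachNoise.comp (by fun_prop)))
  · refine integrable_of_abs_le (M := M * M * N) ?_ fun w => ?_
    · have := measurable_attachNoise (X := X) (Y := Y) (U := U) (V := V) (ι := Fin (2 * r))
      fun_prop
    · have hM0 : 0 ≤ M := (abs_nonneg _).trans
        (hM fun s => attachNoise w ⟨s.1, by have := s.isLt; omega⟩)
      rw [abs_mul, abs_mul]
      gcongr <;> apply_assumption

theorem noisy_mem_piRSet [SFinite μ] [SFinite ν] (h : P ∈ PiRSet r μ ν) :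
    noisy P α β ∈ PiRSet r (μ.prod α) (ν.prod β) := by
  obtain ⟨hP, hs, hm, hpsd⟩ := h
  exact ⟨Measure.isProbabilityMeasure_map measurable_attachNoise.aemeasurable,
    hs.noisy α β, hm.noisy α β, hpsd.noisy α β⟩

theorem map_mem_piRSet [SFinite μ] [SFinite ν] (h : P ∈ PiRSet r μ ν) {φ : X → U} {ψ : Y → V}
    (hφ : Measurable φ) (hψ : Measurable ψ) :
    P.map (fun z i => (φ (z i).1, ψ (z i).2)) ∈ PiRSet r (μ.map φ) (ν.map ψ) := by
  obtain ⟨hP, hs, hm, hpsd⟩ := h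
  have hT : Measurable fun (z : Fin (2 * r) → X × Y) i => (φ (z i).1, ψ (z i).2) := by fun_prop
  refine ⟨Measure.isProbabilityMeasure_map hT.aemeasurable, fun σ => ?_, fun i => ?_, ?_⟩
  · conv_rhs => rw [← hs σ]
    rw [Measure.map_map (by fun_prop) hT, Measure.map_map hT (by fun_prop)]
    rfl
  · obtain ⟨h1, h2⟩ := hm i
    have hR : Measurable fun (z : {j : Fin (2 * r) // j ≠ i} → X × Y) j =>
      (φ (z j).1, ψ (z j).2) := by fun_prop
    have hrest : (P.map (fun (z : Fin (2 * r) → X × Y) i => (φ (z i).1, ψ (z i).2))).map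
        (fun z (j : {j : Fin (2 * r) // j ≠ i}) => z j.1)
        = (P.map (fun z (j : {j : Fin (2 * r) // j ≠ i}) => z j.1)).map
          (fun z j => (φ (z j).1, ψ (z j).2)) := by
      rw [Measure.map_map (by fun_prop) hT, Measure.map_map hR (by fun_prop)]
      rfl
    rw [hrest, Measure.map_prod_map _ _ hφ hR, Measure.map_prod_map _ _ hψ hR, ← h1, ← h2,
      Measure.map_map (by fun_prop) hT, Measure.map_map (by fun_prop) hT,
      Measure.map_map (by fun_prop) (by fun_prop), Measure.map_map (by fun_prop) (by fun_prop)]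
    exact ⟨rfl, rfl⟩
  · rintro t ht f g hf ⟨M, hM⟩ hg ⟨N, hN⟩ hg0
    rw [integral_map hT.aemeasurable (by refine Measurable.aestronglyMeasurable ?_; fun_prop)]
    exact hpsd t ht (fun a => f fun i => (φ (a i).1, ψ (a i).2))
      (fun a => g fun i => (φ (a i).1, ψ (a i).2)) (by fun_prop) ⟨M, fun _ => hM _⟩
      (by fun_prop) ⟨N, fun _ => hN _⟩ fun _ => hg0 _

theorem map_eval_of_mem_piRSet [IsProbabilityMeasure μ] [IsProbabilityMeasure ν]
    (h : P ∈ PiRSet r μ ν) {i j : Fin (2 * r)} (hij : j ≠ i) :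
    P.map (fun z => ((z i).1, (z j).1)) = μ.prod μ ∧
      P.map (fun z => ((z i).2, (z j).2)) = ν.prod ν := by
  obtain ⟨hP, hs, hm, hpsd⟩ := h
  have hrest (k) : IsProbabilityMeasure
      (P.map (fun z (j : {j : Fin (2 * r) // j ≠ k}) => z j.1)) :=
    Measure.isProbabilityMeasure_map (Measurable.aemeasurable (by fun_prop))
  have e1 : P.map (fun z => (z j).1) = μ := by
    have := congrArg (Measure.map Prod.fst) (hm j).1
    rwa [Measure.map_map (by fun_prop) (by fun_prop), Measure.map_fst_prod, measure_univ,
      one_smul] at this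
  have e2 : P.map (fun z => (z j).2) = ν := by
    have := congrArg (Measure.map Prod.fst) (hm j).2
    rwa [Measure.map_map (by fun_prop) (by fun_prop), Measure.map_fst_prod, measure_univ,
      one_smul] at this
  constructor
  · have := congrArg (Measure.map (Prod.map id
      fun w : {j : Fin (2 * r) // j ≠ i} → X × Y => (w ⟨j, hij⟩).1)) (hm i).1
    rw [Measure.map_map (by fun_prop) (by fun_prop),
      ← Measure.map_prod_map _ _ (by fun_prop) (by fun_prop), Measure.map_id,
      Measure.map_map (by fun_prop) (by fun_prop)] at this
    exact this.trans (congrArg μ.prod e1)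
  · have := congrArg (Measure.map (Prod.map id
      fun w : {j : Fin (2 * r) // j ≠ i} → X × Y => (w ⟨j, hij⟩).2)) (hm i).2
    rw [Measure.map_map (by fun_prop) (by fun_prop),
      ← Measure.map_prod_map _ _ (by fun_prop) (by fun_prop), Measure.map_id,
      Measure.map_map (by fun_prop) (by fun_prop)] at this
    exact this.trans (congrArg ν.prod e2)

theorem dirac_mem_piRSet (r : ℕ) :
    Measure.dirac (fun _ => ((), ())) ∈ PiRSet r (Measure.dirac ()) (Measure.dirac ()) := by
  refine ⟨inferInstance, fun σ => ?_, fun i => ?_, ?_⟩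
  · rw [Measure.map_dirac' (by fun_prop)]
  · rw [Measure.map_dirac' (by fun_prop), Measure.map_dirac' (by fun_prop),
      Measure.dirac_prod_dirac]
    exact ⟨rfl, rfl⟩
  · rintro t ht f g hf - hg - hg0
    rw [integral_dirac]
    exact mul_nonneg (mul_self_nonneg _) (hg0 _)

theorem nonempty_piRSet (r : ℕ) (μ : Measure X) (ν : Measure Y) [IsProbabilityMeasure μ]
    [IsProbabilityMeasure ν] : (PiRSet r μ ν).Nonempty := by
  have h := map_mem_piRSet (noisy_mem_piRSet μ ν (dirac_mem_piRSet r)) measurable_snd measurable_snd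
  simp only [Measure.map_snd_prod, measure_univ, one_smul] at h
  exact ⟨_, h⟩

theorem nonempty_couplings (μ : Measure X) (ν : Measure Y) [IsProbabilityMeasure μ]
    [IsProbabilityMeasure ν] : (Couplings μ ν).Nonempty :=
  ⟨μ.prod ν, inferInstance, by simp [Measure.map_fst_prod], by simp [Measure.map_snd_prod]⟩

/-- A coupling is the law of a randomized transport of its second marginal. -/
theorem exists_map_eq_of_mem_couplings [StandardBorelSpace X] {μ : Measure X} {ν : Measure Y}
    {π : Measure (X × Y)} (h : π ∈ Couplings μ ν) :
    ∃ φ : Y × unitInterval → X, Measurable φ ∧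
      (ν.prod (volume : Measure unitInterval)).map (fun w => (φ w, w.1)) = π := by
  obtain ⟨hπ, h1, h2⟩ := h
  have : Nonempty X := (nonempty_of_isProbabilityMeasure π).map Prod.fst
  have : IsProbabilityMeasure ν := h2 ▸ Measure.isProbabilityMeasure_map (by fun_prop)
  let π' := π.map Prod.swap
  have : IsProbabilityMeasure π' := Measure.isProbabilityMeasure_map (by fun_prop)
  have hfst : π'.fst = ν := by
    rw [Measure.fst, Measure.map_map (by fun_prop) (by fun_prop)]; exact h2
  obtain ⟨f, hf, hfκ⟩ := π'.condKernel.exists_measurable_map_eq_unitInterval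
  refine ⟨Function.uncurry f, hf, ?_⟩
  have hπ' : (ν.prod (volume : Measure unitInterval)).map
      (fun w => (w.1, Function.uncurry f w)) = π' := by
    rw [← π'.disintegrate π'.condKernel, hfst]
    ext s hs
    rw [Measure.map_apply (by fun_prop) hs, Measure.compProd_apply hs,
      Measure.prod_apply (measurable_fst.prodMk hf hs)]
    refine lintegral_congr fun y => ?_
    rw [← hfκ y, Measure.map_apply hf.of_uncurry_left (measurable_prodMk_left hs)]
    rfl
  have := congrArg (Measure.map Prod.swap) hπ'
  rwa [Measure.map_map (by fun_prop) (by fun_prop), Measure.map_map (by fun_prop) (by fun_prop),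
    Prod.swap_swap_eq, Measure.map_id] at this

end Auxiliary

section Minkowski

variable {Ω : Type*} [MeasurableSpace Ω] {τ : Measure Ω} [IsProbabilityMeasure τ] {p : ℝ}

theorem integral_abs_add_rpow_le (hp : 1 ≤ p) {f g : Ω → ℝ} (hf : Measurable f)
    (hg : Measurable g) {M : ℝ} (hfM : ∀ w, |f w| ≤ M) (hgM : ∀ w, |g w| ≤ M) :
    (∫ w, |f w + g w| ^ p ∂τ) ^ (1 / p)
      ≤ (∫ w, |f w| ^ p ∂τ) ^ (1 / p) + (∫ w, |g w| ^ p ∂τ) ^ (1 / p) := by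
  have hp0 : 0 < p := by linarith
  have key {h : Ω → ℝ} (hh : MemLp h (ENNReal.ofReal p) τ) :
      eLpNorm h (ENNReal.ofReal p) τ = ENNReal.ofReal ((∫ w, |h w| ^ p ∂τ) ^ (1 / p)) := by
    rw [hh.eLpNorm_eq_integral_rpow_norm (by simpa using hp0) ENNReal.ofReal_ne_top,
      ENNReal.toReal_ofReal hp0.le]
    simp
  have hf' : MemLp f (ENNReal.ofReal p) τ :=
    .of_bound hf.aestronglyMeasurable M (.of_forall hfM)
  have hg' : MemLp g (ENNReal.ofReal p) τ :=
    .of_bound hg.aestronglyMeasurable M (.of_forall hgM)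
  have := eLpNorm_add_le hf.aestronglyMeasurable hg.aestronglyMeasurable (μ := τ)
    (ENNReal.one_le_ofReal.2 hp)
  rw [key hf', key hg', key (hf'.add hg'), ← ENNReal.ofReal_add (by positivity) (by positivity),
    ENNReal.ofReal_le_ofReal_iff (by positivity)] at this
  exact this

theorem integral_abs_sub_rpow_le (hp : 1 ≤ p) {a b c : Ω → ℝ} (ha : Measurable a)
    (hb : Measurable b) (hc : Measurable c) {M : ℝ} (haM : ∀ w, |a w| ≤ M) (hbM : ∀ w, |b w| ≤ M)
    (hcM : ∀ w, |c w| ≤ M) :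
    (∫ w, |a w - c w| ^ p ∂τ) ^ (1 / p)
      ≤ (∫ w, |a w - b w| ^ p ∂τ) ^ (1 / p) + (∫ w, |b w - c w| ^ p ∂τ) ^ (1 / p) := by
  have hsub {x y : ℝ} (hx : |x| ≤ M) (hy : |y| ≤ M) : |x - y| ≤ M + M :=
    (abs_sub x y).trans (add_le_add hx hy)
  simpa using integral_abs_add_rpow_le (τ := τ) hp (ha.sub hb) (hb.sub hc)
    (fun w => hsub (haM w) (hbM w)) (fun w => hsub (hbM w) (hcM w))

end Minkowski

section Triangle

variable {p q : ℝ}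

theorem continuous_distCost {X Y : Type*} [MetricSpace X] [MetricSpace Y] (hp : 1 ≤ p)
    (hq : 1 ≤ q) :
    Continuous fun w : (X × Y) × (X × Y) => distCost p q w.1 w.2 := by
  unfold distCost
  refine Continuous.rpow_const (continuous_abs.comp (Continuous.sub ?_ ?_))
    fun _ => Or.inr (by linarith)
  all_goals exact Continuous.rpow_const (by fun_prop) fun _ => Or.inr (by linarith)

theorem measurable_distCost {X Y : Type*} [MetricSpace X] [SecondCountableTopology X]
    [MeasurableSpace X] [BorelSpace X] [MetricSpace Y] [SecondCountableTopology Y]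
    [MeasurableSpace Y] [BorelSpace Y] (hp : 1 ≤ p) (hq : 1 ≤ q) :
    Measurable fun w : (X × Y) × (X × Y) => distCost p q w.1 w.2 :=
  (continuous_distCost hp hq).measurable

theorem distCost_nonneg {X Y : Type*} [MetricSpace X] [MetricSpace Y] (z w : X × Y) :
    0 ≤ distCost p q z w := by
  unfold distCost; positivity

theorem exists_abs_dist_rpow_le (X : Type*) [MetricSpace X] [CompactSpace X] (hq : 1 ≤ q) :
    ∃ M, ∀ x y : X, |dist x y ^ q| ≤ M := by
  obtain ⟨M, hM⟩ := (isCompact_univ (X := X × X)).exists_bound_of_continuousOn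
    (f := fun w => dist w.1 w.2 ^ q)
    (Continuous.rpow_const (by fun_prop) fun _ => Or.inr (by linarith)).continuousOn
  exact ⟨M, fun x y => hM (x, y) trivial⟩

theorem le_iInf_rpow_add {ι : Type*} [Nonempty ι] {A : ι → ℝ} (hA : ∀ i, 0 ≤ A i) (hp : 1 ≤ p)
    {T C : ℝ} (h : ∀ i, T ≤ A i ^ (1 / p) + C) : T ≤ (⨅ i, A i) ^ (1 / p) + C := by
  have hp0 : 0 < p := by linarith
  have hI : 0 ≤ ⨅ i, A i := le_ciInf hA
  rcases le_total T C with hTC | hTC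
  · have := Real.rpow_nonneg hI (1 / p)
    linarith
  · have hTC' : 0 ≤ T - C := by linarith
    simp only [one_div] at h ⊢
    suffices T - C ≤ (⨅ i, A i) ^ p⁻¹ by linarith
    rw [Real.le_rpow_inv_iff_of_pos hTC' hI hp0]
    refine le_ciInf fun i => ?_
    rw [← Real.le_rpow_inv_iff_of_pos hTC' (hA i) hp0]
    linarith [h i]

theorem gwVal_le {X Y : Type*} [MetricSpace X] [MeasurableSpace X] [MetricSpace Y]
    [MeasurableSpace Y] {μ : Measure X} {ν : Measure Y} {π : Measure (X × Y)}
    (h : π ∈ Couplings μ ν) :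
    gwVal (distCost p q) μ ν ≤ ∫ z, distCost p q z.1 z.2 ∂(π.prod π) :=
  ciInf_le ⟨0, by
    rintro _ ⟨π, rfl⟩
    exact integral_nonneg fun _ => distCost_nonneg _ _⟩ (⟨π, h⟩ : Couplings μ ν)

theorem gwRVal_le {X Y : Type*} [MetricSpace X] [MeasurableSpace X] [MetricSpace Y]
    [MeasurableSpace Y] {r : ℕ} {hr : 0 < r} {μ : Measure X} {ν : Measure Y}
    {P : Measure (Fin (2 * r) → X × Y)} (h : P ∈ PiRSet r μ ν) :
    gwRVal r hr (distCost p q) μ ν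
      ≤ ∫ z, distCost p q (z ⟨0, by omega⟩) (z ⟨1, by omega⟩) ∂P :=
  ciInf_le ⟨0, by
    rintro _ ⟨P, rfl⟩
    exact integral_nonneg fun _ => distCost_nonneg _ _⟩ (⟨P, h⟩ : PiRSet r μ ν)

theorem gwVal_nonneg {X Y : Type*} [MetricSpace X] [MeasurableSpace X] [MetricSpace Y]
    [MeasurableSpace Y] (μ : Measure X) (ν : Measure Y) : 0 ≤ gwVal (distCost p q) μ ν :=
  Real.iInf_nonneg fun _ => integral_nonneg fun _ => distCost_nonneg _ _

variable {X Y : Type*}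
  [MetricSpace X] [CompactSpace X] [PolishSpace X] [MeasurableSpace X] [BorelSpace X]
  [MetricSpace Y] [CompactSpace Y] [PolishSpace Y] [MeasurableSpace Y] [BorelSpace Y]

theorem gwRVal_rpow_le_of_mem (hp : 1 ≤ p) (hq : 1 ≤ q) {r : ℕ} (hr : 0 < r) {μ μ' : Measure X}
    {ν ν' : Measure Y} [IsProbabilityMeasure μ] [IsProbabilityMeasure ν]
    {P : Measure (Fin (2 * r) → X × Y)} (hP : P ∈ PiRSet r μ ν)
    {π : Measure (X × X)} (hπ : π ∈ Couplings μ' μ) {σ : Measure (Y × Y)}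
    (hσ : σ ∈ Couplings ν' ν) :
    gwRVal r hr (distCost p q) μ' ν' ^ (1 / p)
      ≤ (∫ z, distCost p q z.1 z.2 ∂(π.prod π)) ^ (1 / p)
        + ((∫ z, distCost p q z.1 z.2 ∂(σ.prod σ)) ^ (1 / p)
        + (∫ z, distCost p q (z ⟨0, by omega⟩) (z ⟨1, by omega⟩) ∂P) ^ (1 / p)) := by
  obtain ⟨φ, hφ, hφπ⟩ := exists_map_eq_of_mem_couplings hπ
  obtain ⟨ψ, hψ, hψσ⟩ := exists_map_eq_of_mem_couplings hσ
  have hPprob := hP.1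
  have hR := noisy_mem_piRSet (volume : Measure unitInterval) (volume : Measure unitInterval) hP
  have hRP := map_noisy (P := P) (volume : Measure unitInterval) (volume : Measure unitInterval)
  set R := noisy P (volume : Measure unitInterval) (volume : Measure unitInterval)
  have hRprob := hR.1
  have hφμ : (μ.prod (volume : Measure unitInterval)).map φ = μ' := by
    rw [← hπ.2.1, ← hφπ, Measure.map_map (by fun_prop) (by fun_prop)]; rfl
  have hψν : (ν.prod (volume : Measure unitInterval)).map ψ = ν' := by
    rw [← hσ.2.1, ← hψσ, Measure.map_map (by fun_prop) (by fun_prop)]; rfl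
  have hP' := map_mem_piRSet hR hφ hψ
  rw [hφμ, hψν] at hP'
  let i₀ : Fin (2 * r) := ⟨0, by omega⟩
  let i₁ : Fin (2 * r) := ⟨1, by omega⟩
  obtain ⟨hR1, hR2⟩ := map_eval_of_mem_piRSet hR (show i₁ ≠ i₀ by simp [i₀, i₁])
  have hc := measurable_distCost (X := X) (Y := Y) hp hq
  have hcX := measurable_distCost (X := X) (Y := X) hp hq
  have hcY := measurable_distCost (X := Y) (Y := Y) hp hq
  have hcP : Measurable fun z : Fin (2 * r) → X × Y => distCost p q (z i₀) (z i₁) :=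
    hc.comp (f := fun z : Fin (2 * r) → X × Y => (z i₀, z i₁)) (by fun_prop)
  obtain ⟨MX, hMX⟩ := exists_abs_dist_rpow_le X hq
  obtain ⟨MY, hMY⟩ := exists_abs_dist_rpow_le Y hq
  have hMX' x y : |dist (x : X) y ^ q| ≤ max MX MY := (hMX x y).trans (le_max_left _ _)
  have hMY' x y : |dist (x : Y) y ^ q| ≤ max MX MY := (hMY x y).trans (le_max_right _ _)
  let a' : (Fin (2 * r) → (X × unitInterval) × (Y × unitInterval)) → ℝ := fun w =>
    dist (φ (w i₀).1) (φ (w i₁).1) ^ q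
  let b' : (Fin (2 * r) → (X × unitInterval) × (Y × unitInterval)) → ℝ := fun w =>
    dist (ψ (w i₀).2) (ψ (w i₁).2) ^ q
  let a : (Fin (2 * r) → (X × unitInterval) × (Y × unitInterval)) → ℝ := fun w =>
    dist (w i₀).1.1 (w i₁).1.1 ^ q
  let b : (Fin (2 * r) → (X × unitInterval) × (Y × unitInterval)) → ℝ := fun w =>
    dist (w i₀).2.1 (w i₁).2.1 ^ q
  have ha : Measurable a := by fun_prop
  have hb : Measurable b := by fun_prop
  have ha' : Measurable a' := by fun_prop
  have hb' : Measurable b' := by fun_prop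
  have e1 : ∫ z, distCost p q z.1 z.2 ∂(π.prod π) = ∫ w, |a' w - a w| ^ p ∂(R) := by
    rw [← hφπ, Measure.map_prod_map _ _ (by fun_prop) (by fun_prop), ← hR1,
      Measure.map_map (by fun_prop) (by fun_prop), integral_map (by fun_prop)
        hcX.aestronglyMeasurable]
    rfl
  have e2 : ∫ z, distCost p q z.1 z.2 ∂(σ.prod σ) = ∫ w, |b w - b' w| ^ p ∂(R) := by
    simp_rw [abs_sub_comm (b _)]
    rw [← hψσ, Measure.map_prod_map _ _ (by fun_prop) (by fun_prop), ← hR2,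
      Measure.map_map (by fun_prop) (by fun_prop), integral_map (by fun_prop)
        hcY.aestronglyMeasurable]
    rfl
  have e3 : ∫ z, distCost p q (z i₀) (z i₁) ∂P = ∫ w, |a w - b w| ^ p ∂(R) := by
    rw [← hRP, integral_map (by fun_prop) hcP.aestronglyMeasurable]
    rfl
  refine (Real.rpow_le_rpow (Real.iInf_nonneg fun _ => integral_nonneg fun _ =>
    distCost_nonneg _ _) (gwRVal_le (hr := hr) hP') (by positivity)).trans ?_
  rw [integral_map (by fun_prop) hcP.aestronglyMeasurable, e1, e2, e3]
  have t1 := integral_abs_sub_rpow_le (τ := R) hp ha' ha hb' (fun _ => hMX' _ _)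
    (fun _ => hMX' _ _) (fun _ => hMY' _ _)
  have t2 := integral_abs_sub_rpow_le (τ := R) hp ha hb hb' (fun _ => hMX' _ _)
    (fun _ => hMY' _ _) (fun _ => hMY' _ _)
  rw [add_comm] at t2
  exact t1.trans (add_le_add_right t2 _)

theorem gwRVal_rpow_le (hp : 1 ≤ p) (hq : 1 ≤ q) {r : ℕ} (hr : 0 < r) (μ μ' : Measure X)
    (ν ν' : Measure Y) [IsProbabilityMeasure μ] [IsProbabilityMeasure ν]
    [IsProbabilityMeasure μ'] [IsProbabilityMeasure ν'] :
    gwRVal r hr (distCost p q) μ' ν' ^ (1 / p)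
      ≤ gwVal (distCost p q) μ' μ ^ (1 / p) + (gwVal (distCost p q) ν' ν ^ (1 / p)
        + gwRVal r hr (distCost p q) μ ν ^ (1 / p)) := by
  have := (nonempty_couplings μ' μ).to_subtype
  have := (nonempty_couplings ν' ν).to_subtype
  have := (nonempty_piRSet r μ ν).to_subtype
  refine le_iInf_rpow_add (fun _ => integral_nonneg fun _ => distCost_nonneg _ _) hp fun π => ?_
  rw [add_left_comm]
  refine le_iInf_rpow_add (fun _ => integral_nonneg fun _ => distCost_nonneg _ _) hp fun σ => ?_
  rw [← add_assoc, add_comm]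
  refine le_iInf_rpow_add (fun _ => integral_nonneg fun _ => distCost_nonneg _ _) hp fun P => ?_
  have := gwRVal_rpow_le_of_mem hp hq hr P.2 π.2 σ.2
  linarith

theorem gwVal_rpow_le (hp : 1 ≤ p) (hq : 1 ≤ q) (μ μ' : Measure X) (ν : Measure Y)
    [IsProbabilityMeasure μ] [IsProbabilityMeasure μ'] [IsProbabilityMeasure ν] :
    gwVal (distCost p q) μ' ν ^ (1 / p)
      ≤ gwVal (distCost p q) μ' μ ^ (1 / p) + gwVal (distCost p q) μ ν ^ (1 / p) := by
  have := (nonempty_couplings μ' μ).to_subtype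
  have := (nonempty_couplings μ ν).to_subtype
  refine le_iInf_rpow_add (fun _ => integral_nonneg fun _ => distCost_nonneg _ _) hp fun π => ?_
  rw [add_comm]
  refine le_iInf_rpow_add (fun _ => integral_nonneg fun _ => distCost_nonneg _ _) hp fun σ => ?_
  obtain ⟨π, hπ⟩ := π
  obtain ⟨σ, hσ⟩ := σ
  obtain ⟨φ, hφ, hφπ⟩ := exists_map_eq_of_mem_couplings hπ
  have hσprob := hσ.1
  let R := σ.prod (volume : Measure unitInterval)
  have hRμ : R.map (fun w => (w.1.1, w.2)) = μ.prod (volume : Measure unitInterval) := by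
    rw [← hσ.2.1]
    conv_rhs => rw [← Measure.map_id (μ := (volume : Measure unitInterval))]
    rw [Measure.map_prod_map _ _ (by fun_prop) (by fun_prop)]
    rfl
  have hRσ : R.map Prod.fst = σ := measurePreserving_fst.map_eq
  have hRπ : R.map (fun w => (φ (w.1.1, w.2), w.1.1)) = π := by
    rw [← hφπ, ← hRμ, Measure.map_map (by fun_prop) (by fun_prop)]; rfl
  have hmem : R.map (fun w => (φ (w.1.1, w.2), w.1.2)) ∈ Couplings μ' ν := by
    refine ⟨Measure.isProbabilityMeasure_map (by fun_prop), ?_, ?_⟩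
    · rw [← hπ.2.1, ← hRπ, Measure.map_map (by fun_prop) (by fun_prop),
        Measure.map_map (by fun_prop) (by fun_prop)]
      rfl
    · rw [← hσ.2.2, ← hRσ, Measure.map_map (by fun_prop) (by fun_prop),
        Measure.map_map (by fun_prop) (by fun_prop)]
      rfl
  have hc := measurable_distCost (X := X) (Y := Y) hp hq
  have hcX := measurable_distCost (X := X) (Y := X) hp hq
  obtain ⟨MX, hMX⟩ := exists_abs_dist_rpow_le X hq
  obtain ⟨MY, hMY⟩ := exists_abs_dist_rpow_le Y hq
  have hMX' x y : |dist (x : X) y ^ q| ≤ max MX MY := (hMX x y).trans (le_max_left _ _)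
  have hMY' x y : |dist (x : Y) y ^ q| ≤ max MX MY := (hMY x y).trans (le_max_right _ _)
  refine (Real.rpow_le_rpow (gwVal_nonneg _ _) (gwVal_le hmem) (by positivity)).trans ?_
  simp only
  rw [add_comm]
  have e1 : ∫ z, distCost p q z.1 z.2 ∂(σ.prod σ)
      = ∫ w, distCost p q w.1.1 w.2.1 ∂(R.prod R) := by
    rw [← hRσ, Measure.map_prod_map _ _ (by fun_prop) (by fun_prop),
      integral_map (by fun_prop) hc.aestronglyMeasurable]
    rfl
  rw [e1, ← hRπ, Measure.map_prod_map _ _ (by fun_prop) (by fun_prop),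
    Measure.map_prod_map _ _ (by fun_prop) (by fun_prop),
    integral_map (by fun_prop) hc.aestronglyMeasurable,
    integral_map (by fun_prop) hcX.aestronglyMeasurable]
  exact integral_abs_sub_rpow_le (τ := R.prod R) hp
    (a := fun w => dist (φ (w.1.1.1, w.1.2)) (φ (w.2.1.1, w.2.2)) ^ q)
    (b := fun w => dist w.1.1.1 w.2.1.1 ^ q) (c := fun w => dist w.1.1.2 w.2.1.2 ^ q)
    (by fun_prop) (by fun_prop) (by fun_prop)
    (fun _ => hMX' _ _) (fun _ => hMX' _ _) (fun _ => hMY' _ _)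

theorem gwVal_le_gwVal_swap (hp : 1 ≤ p) (hq : 1 ≤ q) (μ : Measure X) (ν : Measure Y)
    [IsProbabilityMeasure μ] [IsProbabilityMeasure ν] :
    gwVal (distCost p q) μ ν ≤ gwVal (distCost p q) ν μ := by
  have := (nonempty_couplings ν μ).to_subtype
  refine le_ciInf fun ⟨π, hπ⟩ => ?_
  have hπprob := hπ.1
  have hmem : π.map Prod.swap ∈ Couplings μ ν := by
    refine ⟨Measure.isProbabilityMeasure_map (by fun_prop), ?_, ?_⟩
    · rw [← hπ.2.2, Measure.map_map (by fun_prop) (by fun_prop)]; rfl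
    · rw [← hπ.2.1, Measure.map_map (by fun_prop) (by fun_prop)]; rfl
  refine (gwVal_le hmem).trans_eq ?_
  rw [Measure.map_prod_map _ _ (by fun_prop) (by fun_prop), integral_map (by fun_prop)
    (measurable_distCost hp hq).aestronglyMeasurable]
  simp [distCost, abs_sub_comm]

theorem gwVal_comm (hp : 1 ≤ p) (hq : 1 ≤ q) (μ : Measure X) (ν : Measure Y)
    [IsProbabilityMeasure μ] [IsProbabilityMeasure ν] :
    gwVal (distCost p q) μ ν = gwVal (distCost p q) ν μ :=
  (gwVal_le_gwVal_swap hp hq μ ν).antisymm (gwVal_le_gwVal_swap hp hq ν μ)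

end Triangle

section Empirical

theorem empMeas_eq_map {X : Type*} [MeasurableSpace X] (n : ℕ) (ω : Fin n → X) :
    empMeas n ω = (empMeas n (id : Fin n → Fin n)).map ω := by
  have hω : Measurable ω := measurable_of_countable ω
  ext s hs
  rw [Measure.map_apply hω hs]
  simp [empMeas, Measure.dirac_apply' _ hs, Measure.dirac_apply' _ (hω hs)]
  rfl

theorem isProbabilityMeasure_empMeas {X : Type*} [MeasurableSpace X] {n : ℕ} (hn : n ≠ 0)
    (ω : Fin n → X) : IsProbabilityMeasure (empMeas n ω) where
  measure_univ := by
    simp [empMeas, ENNReal.mul_inv_cancel (Nat.cast_ne_zero.2 hn) (ENNReal.natCast_ne_top n)]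

theorem gwVal_map_map_le {p q : ℝ} {Ω X Y : Type*} [MeasurableSpace Ω]
    [MetricSpace X] [PolishSpace X] [MeasurableSpace X] [BorelSpace X]
    [MetricSpace Y] [PolishSpace Y] [MeasurableSpace Y] [BorelSpace Y] (hp : 1 ≤ p) (hq : 1 ≤ q)
    (τ : Measure Ω) [IsProbabilityMeasure τ] {f : Ω → X} {g : Ω → Y} (hf : Measurable f)
    (hg : Measurable g) :
    gwVal (distCost p q) (τ.map f) (τ.map g)
      ≤ ∫ w, distCost p q (f w.1, g w.1) (f w.2, g w.2) ∂(τ.prod τ) := by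
  have hmem : τ.map (fun w => (f w, g w)) ∈ Couplings (τ.map f) (τ.map g) := by
    refine ⟨Measure.isProbabilityMeasure_map (by fun_prop), ?_, ?_⟩ <;>
    · rw [Measure.map_map (by fun_prop) (by fun_prop)]; rfl
  refine (gwVal_le hmem).trans_eq ?_
  rw [Measure.map_prod_map _ _ (by fun_prop) (by fun_prop), integral_map (by fun_prop)
    (measurable_distCost hp hq).aestronglyMeasurable]
  rfl

theorem tendsto_gwVal_empMeas_rpow {p q : ℝ} {X : Type*} [MetricSpace X] [PolishSpace X]
    [MeasurableSpace X] [BorelSpace X] (hp : 1 ≤ p) (hq : 1 ≤ q) {n : ℕ} (hn : n ≠ 0)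
    (ω : Fin n → X) :
    Tendsto (fun ω' => gwVal (distCost p q) (empMeas n ω') (empMeas n ω) ^ (1 / p)) (nhds ω)
      (nhds 0) := by
  have hp0 : 0 < p := by linarith
  let τ := empMeas n (id : Fin n → Fin n)
  have : IsProbabilityMeasure τ := isProbabilityMeasure_empMeas hn _
  let S : (Fin n → X) → ℝ := fun ω' =>
    ∫ w, distCost p q (ω' w.1, ω w.1) (ω' w.2, ω w.2) ∂(τ.prod τ)
  have hS : Continuous S := by
    simp only [S, integral_fintype (.of_finite)]
    refine continuous_finsetSum _ fun w _ => ?_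
    have h := (continuous_distCost hp hq).comp
      (f := fun ω' : Fin n → X => ((ω' w.1, ω w.1), (ω' w.2, ω w.2))) (by fun_prop)
    exact h.const_smul ((τ.prod τ).real {w})
  have hSω : S ω = 0 := by simp [S, distCost, Real.zero_rpow hp0.ne']
  have hSt : Tendsto (fun ω' => S ω' ^ (1 / p)) (nhds ω) (nhds 0) := by
    have h := (hS.rpow_const (p := 1 / p) fun _ => Or.inr (by positivity)).tendsto ω
    rwa [hSω, Real.zero_rpow (by positivity)] at h
  refine squeeze_zero (fun _ => Real.rpow_nonneg (gwVal_nonneg _ _) _) (fun ω' => ?_) hSt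
  refine Real.rpow_le_rpow (gwVal_nonneg _ _) ?_ (by positivity)
  rw [empMeas_eq_map n ω', empMeas_eq_map n ω]
  exact gwVal_map_map_le hp hq τ (measurable_of_countable _) (measurable_of_countable _)

variable {p q : ℝ} {X Y : Type*}
  [MetricSpace X] [CompactSpace X] [PolishSpace X] [MeasurableSpace X] [BorelSpace X]
  [MetricSpace Y] [CompactSpace Y] [PolishSpace Y] [MeasurableSpace Y] [BorelSpace Y]

theorem abs_gwRVal_rpow_sub_le (hp : 1 ≤ p) (hq : 1 ≤ q) {r : ℕ} (hr : 0 < r) (μ μ' : Measure X)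
    (ν ν' : Measure Y) [IsProbabilityMeasure μ] [IsProbabilityMeasure ν]
    [IsProbabilityMeasure μ'] [IsProbabilityMeasure ν'] :
    |gwRVal r hr (distCost p q) μ' ν' ^ (1 / p) - gwRVal r hr (distCost p q) μ ν ^ (1 / p)|
      ≤ gwVal (distCost p q) μ' μ ^ (1 / p) + gwVal (distCost p q) ν' ν ^ (1 / p) := by
  have h₁ := gwRVal_rpow_le hp hq hr μ μ' ν ν'
  have h₂ := gwRVal_rpow_le hp hq hr μ' μ ν' ν
  rw [gwVal_comm hp hq μ, gwVal_comm hp hq ν] at h₂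
  exact abs_le.2 ⟨by linarith, by linarith⟩

theorem abs_gwVal_rpow_sub_le (hp : 1 ≤ p) (hq : 1 ≤ q) (μ μ' : Measure X) (ν : Measure Y)
    [IsProbabilityMeasure μ] [IsProbabilityMeasure μ'] [IsProbabilityMeasure ν] :
    |gwVal (distCost p q) μ' ν ^ (1 / p) - gwVal (distCost p q) μ ν ^ (1 / p)|
      ≤ gwVal (distCost p q) μ' μ ^ (1 / p) := by
  have h₁ := gwVal_rpow_le hp hq μ μ' ν
  have h₂ := gwVal_rpow_le hp hq μ' μ ν
  rw [gwVal_comm hp hq μ μ'] at h₂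
  exact abs_le.2 ⟨by linarith, by linarith⟩

theorem continuous_gwVal_empMeas_rpow (hp : 1 ≤ p) (hq : 1 ≤ q) {n : ℕ} (hn : n ≠ 0)
    (μ : Measure X) [IsProbabilityMeasure μ] :
    Continuous fun ω : Fin n → X => gwVal (distCost p q) (empMeas n ω) μ ^ (1 / p) := by
  have hprob (ω : Fin n → X) := isProbabilityMeasure_empMeas hn ω
  refine continuous_iff_continuousAt.2 fun ω => tendsto_iff_dist_tendsto_zero.2 ?_
  exact squeeze_zero (fun _ => dist_nonneg)
    (fun ω' => abs_gwVal_rpow_sub_le hp hq (empMeas n ω) (empMeas n ω') μ)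
    (tendsto_gwVal_empMeas_rpow hp hq hn ω)

theorem continuous_gwRVal_empMeas_rpow (hp : 1 ≤ p) (hq : 1 ≤ q) {r : ℕ} (hr : 0 < r) {n : ℕ}
    (hn : n ≠ 0) :
    Continuous fun ω : (Fin n → X) × (Fin n → Y) =>
      gwRVal r hr (distCost p q) (empMeas n ω.1) (empMeas n ω.2) ^ (1 / p) := by
  have hprobX (ω : Fin n → X) := isProbabilityMeasure_empMeas hn ω
  have hprobY (ω : Fin n → Y) := isProbabilityMeasure_empMeas hn ω
  refine continuous_iff_continuousAt.2 fun ω => tendsto_iff_dist_tendsto_zero.2 ?_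
  refine squeeze_zero (fun _ => dist_nonneg)
    (fun ω' => abs_gwRVal_rpow_sub_le hp hq hr (empMeas n ω.1) (empMeas n ω'.1) (empMeas n ω.2)
      (empMeas n ω'.2)) ?_
  simpa using ((tendsto_gwVal_empMeas_rpow hp hq hn ω.1).comp continuous_fst.continuousAt).add
    ((tendsto_gwVal_empMeas_rpow hp hq hn ω.2).comp continuous_snd.continuousAt)

theorem abs_integral_gwRVal_empMeas_sub_le (hp : 1 ≤ p) (hq : 1 ≤ q) {r : ℕ} (hr : 0 < r) {n : ℕ}
    (hn : n ≠ 0) (μ : Measure X) (ν : Measure Y) [IsProbabilityMeasure μ]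
    [IsProbabilityMeasure ν] :
    |∫ ω : (Fin n → X) × (Fin n → Y),
          (gwRVal r hr (distCost p q) (empMeas n ω.1) (empMeas n ω.2)) ^ (1 / p)
        ∂((Measure.pi fun _ : Fin n => μ).prod (Measure.pi fun _ : Fin n => ν))
      - gwRVal r hr (distCost p q) μ ν ^ (1 / p)|
      ≤ ∫ ω, (gwVal (distCost p q) (empMeas n ω) μ) ^ (1 / p) ∂(Measure.pi fun _ : Fin n => μ)
        + ∫ ω, (gwVal (distCost p q) (empMeas n ω) ν) ^ (1 / p)
          ∂(Measure.pi fun _ : Fin n => ν) := by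
  have hprobX (ω : Fin n → X) := isProbabilityMeasure_empMeas hn ω
  have hprobY (ω : Fin n → Y) := isProbabilityMeasure_empMeas hn ω
  set M := Measure.pi fun _ : Fin n => μ
  set N := Measure.pi fun _ : Fin n => ν
  have hR : Integrable (fun ω : (Fin n → X) × (Fin n → Y) =>
      gwRVal r hr (distCost p q) (empMeas n ω.1) (empMeas n ω.2) ^ (1 / p)) (M.prod N) :=
    (continuous_gwRVal_empMeas_rpow hp hq hr hn).integrable_of_hasCompactSupport
      (.of_compactSpace _)
  have hM : Integrable (fun ω => gwVal (distCost p q) (empMeas n ω) μ ^ (1 / p)) M :=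
    (continuous_gwVal_empMeas_rpow hp hq hn μ).integrable_of_hasCompactSupport
      (.of_compactSpace _)
  have hN : Integrable (fun ω => gwVal (distCost p q) (empMeas n ω) ν ^ (1 / p)) N :=
    (continuous_gwVal_empMeas_rpow hp hq hn ν).integrable_of_hasCompactSupport
      (.of_compactSpace _)
  calc _ = |∫ ω, (gwRVal r hr (distCost p q) (empMeas n ω.1) (empMeas n ω.2) ^ (1 / p)
          - gwRVal r hr (distCost p q) μ ν ^ (1 / p)) ∂(M.prod N)| := by
        rw [integral_sub hR (integrable_const _)]; simp
    _ ≤ ∫ ω, |gwRVal r hr (distCost p q) (empMeas n ω.1) (empMeas n ω.2) ^ (1 / p)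
          - gwRVal r hr (distCost p q) μ ν ^ (1 / p)| ∂(M.prod N) := abs_integral_le_integral_abs
    _ ≤ ∫ ω, (gwVal (distCost p q) (empMeas n ω.1) μ ^ (1 / p)
          + gwVal (distCost p q) (empMeas n ω.2) ν ^ (1 / p)) ∂(M.prod N) :=
        integral_mono (hR.sub (integrable_const _)).abs ((hM.comp_fst N).add (hN.comp_snd M))
          fun _ => abs_gwRVal_rpow_sub_le hp hq hr _ _ _ _
    _ = _ := by
        rw [integral_add (hM.comp_fst N) (hN.comp_snd M),
          integral_fun_fst fun ω => gwVal (distCost p q) (empMeas n ω) μ ^ (1 / p),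
          integral_fun_snd fun ω => gwVal (distCost p q) (empMeas n ω) ν ^ (1 / p)]
        simp

end Empirical

theorem stmt15 {X Y : Type*}
    [MetricSpace X] [CompactSpace X] [PolishSpace X] [MeasurableSpace X] [BorelSpace X]
    [MetricSpace Y] [CompactSpace Y] [PolishSpace Y] [MeasurableSpace Y] [BorelSpace Y]
    (hdX : Metric.diam (Set.univ : Set X) ≤ 1) (hdY : Metric.diam (Set.univ : Set Y) ≤ 1)
    (μ : Measure X) (ν : Measure Y) [IsProbabilityMeasure μ] [IsProbabilityMeasure ν]
    (p q : ℝ) (hp : 1 ≤ p) (hq : 1 ≤ q)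
    (r : ℕ) (hr : 0 < r)
    (hX : Filter.Tendsto
      (fun n : ℕ => ∫ ω, (gwVal (distCost p q) (empMeas n ω) μ) ^ (1 / p)
        ∂(Measure.pi fun _ : Fin n => μ)) Filter.atTop (nhds 0))
    (hY : Filter.Tendsto
      (fun n : ℕ => ∫ ω, (gwVal (distCost p q) (empMeas n ω) ν) ^ (1 / p)
        ∂(Measure.pi fun _ : Fin n => ν)) Filter.atTop (nhds 0)) :
    Filter.Tendsto
      (fun n : ℕ =>
        ∫ ω : (Fin n → X) × (Fin n → Y),
          (gwRVal r hr (distCost p q) (empMeas n ω.1) (empMeas n ω.2)) ^ (1 / p)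
        ∂((Measure.pi fun _ : Fin n => μ).prod (Measure.pi fun _ : Fin n => ν)))
      Filter.atTop
      (nhds ((gwRVal r hr (distCost p q) μ ν) ^ (1 / p))) := by
  have hb := hX.add hY
  rw [add_zero] at hb
  refine tendsto_iff_dist_tendsto_zero.2 (squeeze_zero' (.of_forall fun _ => dist_nonneg) ?_ hb)
  filter_upwards [eventually_ne_atTop 0] with n hn
  exact abs_integral_gwRVal_empMeas_sub_le hp hq hr hn μ ν

end GWSOS
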